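/- Let p ∈ [1, ∞), let n, d ≥ 1 be integers, and let 𝐛 be a complex d×(nd) matrix. Then the p-operator norm of 𝐛 equals the supremum of the p-operator norms ‖𝐛a‖_p over all complex (nd)×d matrices a with p-operator norm at most 1; moreover this supremum is attained. (This is the second C*-likeness condition for the row-column module over A = M_d^p(ℂ).) -/

import Mathlib

open scoped ENNReal

/-- The `(p → q)`-operator norm of a complex matrix, i.e. its norm as a linear
operator from `ℓ^p` to `ℓ^q` (finite-dimensional). -/
noncomputable def opNorm (p q : ℝ≥0∞) [Fact (1 ≤ p)] [Fact (1 ≤ q)]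
    {ι κ : Type*} [Fintype ι] [Fintype κ] (a : Matrix ι κ ℂ) : ℝ :=
  ‖LinearMap.toContinuousLinearMap
    (((WithLp.linearEquiv q ℂ (ι → ℂ)).symm.toLinearMap.comp
      a.mulVecLin).comp (WithLp.linearEquiv p ℂ (κ → ℂ)).toLinearMap)‖

/-- The continuous linear map `ℓ^p → ℓ^p` given by a matrix. -/
noncomputable def matrixCLM (p : ℝ≥0∞) [Fact (1 ≤ p)] {ι κ : Type*} [Fintype ι] [Fintype κ]
    (a : Matrix ι κ ℂ) : PiLp p (fun _ : κ => ℂ) →L[ℂ] PiLp p (fun _ : ι => ℂ) :=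
  LinearMap.toContinuousLinearMap
    (((WithLp.linearEquiv p ℂ (ι → ℂ)).symm.toLinearMap.comp
      a.mulVecLin).comp (WithLp.linearEquiv p ℂ (κ → ℂ)).toLinearMap)

theorem norm_matrixCLM (p : ℝ≥0∞) [Fact (1 ≤ p)] {ι κ : Type*} [Fintype ι] [Fintype κ]
    (a : Matrix ι κ ℂ) : ‖matrixCLM p a‖ = opNorm p p a := rfl

theorem matrixCLM_apply (p : ℝ≥0∞) [Fact (1 ≤ p)] {ι κ : Type*} [Fintype ι] [Fintype κ]
    (a : Matrix ι κ ℂ) (x : PiLp p (fun _ : κ => ℂ)) :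
    matrixCLM p a x = WithLp.toLp p (a.mulVec x.ofLp) := rfl

theorem opNorm_mul_le (p : ℝ≥0∞) [Fact (1 ≤ p)] {ι κ μ : Type*}
    [Fintype ι] [Fintype κ] [Fintype μ] (a : Matrix ι κ ℂ) (b : Matrix κ μ ℂ) :
    opNorm p p (a * b) ≤ opNorm p p a * opNorm p p b := by
  have h : matrixCLM p (a * b) = (matrixCLM p a).comp (matrixCLM p b) := by
    ext1 x
    simp [matrixCLM_apply, Matrix.mulVec_mulVec]
  simpa only [← norm_matrixCLM, h] using (matrixCLM p a).opNorm_comp_le (matrixCLM p b)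

/-- A continuous linear map out of a proper space attains its norm on the closed unit ball. -/
theorem exists_norm_le_one_norm_apply_eq {E F : Type*} [NormedAddCommGroup E] [NormedSpace ℂ E]
    [ProperSpace E] [NormedAddCommGroup F] [NormedSpace ℂ F] (f : E →L[ℂ] F) :
    ∃ x : E, ‖x‖ ≤ 1 ∧ ‖f x‖ = ‖f‖ := by
  obtain ⟨x, hx, h⟩ := (isCompact_closedBall (0 : E) 1).exists_sSup_image_eq
    ⟨0, by simp⟩ (f.continuous.norm.continuousOn)
  exact ⟨x, by simpa using hx, by rw [← h, f.sSup_unitClosedBall_eq_norm]⟩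

theorem stmt_3 (p : ℝ≥0∞) [Fact (1 ≤ p)] (hp : p ≠ ∞)
    (n d : ℕ) (hn : 0 < n) (hd : 0 < d)
    (B : Matrix (Fin d) (Fin (n * d)) ℂ) :
    IsGreatest
      {r : ℝ | ∃ a : Matrix (Fin (n * d)) (Fin d) ℂ,
        opNorm p p a ≤ 1 ∧ r = opNorm p p (B * a)}
      (opNorm p p B) := by
  have mul_le (a : Matrix (Fin (n * d)) (Fin d) ℂ) (ha : opNorm p p a ≤ 1) :
      opNorm p p (B * a) ≤ opNorm p p B :=
    (opNorm_mul_le p B a).trans (mul_le_of_le_one_right (norm_nonneg (matrixCLM p B)) ha)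
  refine ⟨?_, fun r ⟨a, ha, hr⟩ => hr ▸ mul_le a ha⟩
  obtain ⟨ξ, hξ, hBξ⟩ := exists_norm_le_one_norm_apply_eq (matrixCLM p B)
  let i : Fin d := ⟨0, hd⟩
  let a : Matrix (Fin (n * d)) (Fin d) ℂ := Matrix.vecMulVec ξ.ofLp (Pi.single i 1)
  have apply_a (x : PiLp p (fun _ : Fin d => ℂ)) : matrixCLM p a x = x i • ξ := by
    ext j
    simp [matrixCLM_apply, a, Matrix.vecMulVec_mulVec, mul_comm]
  have ha : opNorm p p a ≤ 1 := by
    rw [← norm_matrixCLM]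
    refine ContinuousLinearMap.opNorm_le_bound _ zero_le_one fun x => ?_
    rw [apply_a, norm_smul, mul_comm]
    exact mul_le_mul hξ (PiLp.norm_apply_le x i) (norm_nonneg _) zero_le_one
  refine ⟨a, ha, le_antisymm ?_ (mul_le a ha)⟩
  let e : PiLp p (fun _ : Fin d => ℂ) := PiLp.single p i 1
  have he : matrixCLM p (B * a) e = matrixCLM p B ξ := by
    have hae : matrixCLM p a e = ξ := by simp [apply_a, e]
    rw [← hae]
    simp [matrixCLM_apply, Matrix.mulVec_mulVec]
  have h := (matrixCLM p (B * a)).le_opNorm e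
  rwa [he, hBξ, PiLp.norm_single, norm_one, mul_one] at h
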